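/- Consider the $L_\infty$ approximation problem ${\rm APP} = \{{\rm APP}_{\infty,d}\}_{d \in \mathbb{N}}$ over the weighted Korobov spaces $H(K_{d,\mathbf{r},\mathbf{g}})$ in the worst case setting, for either information class $\Lambda \in \{\Lambda^{\rm std}, \Lambda^{\rm all}\}$ and either error criterion $\star \in \{{\rm ABS}, {\rm NOR}\}$. Then ${\rm APP}$ is algebraically strongly polynomially tractable if and only if it is algebraically polynomially tractable, if and only if $\liminf_{j \to \infty} \frac{\ln(1/g_j)}{\ln j} > 1$. -/

import Mathlib

open Filter
open scoped ENNReal NNReal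

noncomputable section

/-- Coefficient space: `ℓ²` sequences indexed by `ℤ^d`.  An element `u` represents the
function `f ∈ H^ω(𝕋^d)` with Fourier coefficients `f̂(k) = u k / ω k`, so that
`‖u‖_{ℓ²} = ‖f‖_{H^ω}`. -/
abbrev Coef (d : ℕ) := lp (fun _ : Fin d → ℤ => ℂ) 2

/-- The periodic function represented by the coefficients `u`:
`f(x) = ∑_{k ∈ ℤ^d} (u k / ω k) e^{2πi k·x}`. -/
def torusFn {d : ℕ} (ω : (Fin d → ℤ) → ℝ) (u : Coef d) (x : Fin d → ℝ) : ℂ :=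
  ∑' k : Fin d → ℤ,
    ((ω k : ℂ))⁻¹ * u k * Complex.exp (2 * Real.pi * Complex.I * ∑ j, (k j : ℂ) * (x j : ℂ))

/-- The torus `𝕋^d`, modelled as the cube `[0,1]^d`. -/
def cube (d : ℕ) : Set (Fin d → ℝ) := {x | ∀ j, x j ∈ Set.Icc (0 : ℝ) 1}

/-- Standard information: point-evaluation functionals `f ↦ f(x)`. -/
def stdInfo {d : ℕ} (ω : (Fin d → ℤ) → ℝ) : Set (Coef d → ℂ) :=
  {L | ∃ x ∈ cube d, L = fun u => torusFn ω u x}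

/-- General linear information: all continuous linear functionals on `H^ω`. -/
def allInfo (d : ℕ) : Set (Coef d → ℂ) := {L | ∃ T : Coef d →L[ℂ] ℂ, L = ⇑T}

/-- The `n`-th minimal worst case error `e(n, APP_{∞,d}; Λ)` of `L_∞`-approximation on the
unit ball of `H^ω(𝕋^d)`, using algorithms `f ↦ φ(L₁ f, …, Lₙ f)` with `Lᵢ ∈ Λ`. -/
def wcErr {d : ℕ} (ω : (Fin d → ℤ) → ℝ) (Λ : Set (Coef d → ℂ)) (n : ℕ) : ℝ≥0∞ :=
  ⨅ (L : Fin n → Coef d → ℂ) (_ : ∀ i, L i ∈ Λ) (φ : (Fin n → ℂ) → (Fin d → ℝ) → ℂ),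
    ⨆ (u : Coef d) (_ : ‖u‖ ≤ 1) (x : Fin d → ℝ) (_ : x ∈ cube d),
      (‖torusFn ω u x - φ (fun i => L i u) x‖₊ : ℝ≥0∞)

/-- The initial error `e(0, APP_{∞,d}) = sup_{‖f‖_{H^ω} ≤ 1} ‖f‖_∞`. -/
def initErr {d : ℕ} (ω : (Fin d → ℤ) → ℝ) : ℝ≥0∞ :=
  ⨆ (u : Coef d) (_ : ‖u‖ ≤ 1) (x : Fin d → ℝ) (_ : x ∈ cube d),
    (‖torusFn ω u x‖₊ : ℝ≥0∞)

/-- The error criterion: absolute (ABS) or normalized (NOR). -/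
inductive Crit | ABS | NOR

/-- `CRI_d`: the normalizing quantity of the error criterion. -/
def CRI {d : ℕ} (ω : (Fin d → ℤ) → ℝ) : Crit → ℝ≥0∞
  | Crit.ABS => 1
  | Crit.NOR => initErr ω

/-- The information complexity `n^⋆(ε, d; Λ)`. -/
def infoComp {d : ℕ} (ω : (Fin d → ℤ) → ℝ) (Λ : Set (Coef d → ℂ)) (crit : Crit) (ε : ℝ) : ℕ :=
  sInf {n : ℕ | wcErr ω Λ n ≤ ENNReal.ofReal ε * CRI ω crit}

/-- Algebraic strong polynomial tractability of the family of information complexities `nc`. -/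
def ALGSPT (nc : ℕ → ℝ → ℕ) : Prop :=
  ∃ C > (0:ℝ), ∃ p ≥ (0:ℝ), ∀ d : ℕ, 0 < d → ∀ ε ∈ Set.Ioo (0:ℝ) 1,
    (nc d ε : ℝ) ≤ C * ε ^ (-p)

/-- The exponent of algebraic strong polynomial tractability. -/
def ALGSPTexp (nc : ℕ → ℝ → ℕ) : ℝ :=
  sInf {p : ℝ | 0 ≤ p ∧ ∃ C > (0:ℝ), ∀ d : ℕ, 0 < d → ∀ ε ∈ Set.Ioo (0:ℝ) 1,
    (nc d ε : ℝ) ≤ C * ε ^ (-p)}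

/-- Algebraic polynomial tractability. -/
def ALGPT (nc : ℕ → ℝ → ℕ) : Prop :=
  ∃ C > (0:ℝ), ∃ p ≥ (0:ℝ), ∃ q ≥ (0:ℝ), ∀ d : ℕ, 0 < d → ∀ ε ∈ Set.Ioo (0:ℝ) 1,
    (nc d ε : ℝ) ≤ C * (d : ℝ) ^ q * ε ^ (-p)

/-- Algebraic quasi-polynomial tractability. -/
def ALGQPT (nc : ℕ → ℝ → ℕ) : Prop :=
  ∃ C > (0:ℝ), ∃ t ≥ (0:ℝ), ∀ d : ℕ, 0 < d → ∀ ε ∈ Set.Ioo (0:ℝ) 1,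
    (nc d ε : ℝ) ≤ C * Real.exp (t * (1 + Real.log d) * (1 + Real.log ε⁻¹))

/-- The exponent of algebraic quasi-polynomial tractability. -/
def ALGQPTexp (nc : ℕ → ℝ → ℕ) : ℝ :=
  sInf {t : ℝ | 0 ≤ t ∧ ∃ C > (0:ℝ), ∀ d : ℕ, 0 < d → ∀ ε ∈ Set.Ioo (0:ℝ) 1,
    (nc d ε : ℝ) ≤ C * Real.exp (t * (1 + Real.log d) * (1 + Real.log ε⁻¹))}

/-- Exponential quasi-polynomial tractability. -/
def EXPQPT (nc : ℕ → ℝ → ℕ) : Prop :=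
  ∃ C > (0:ℝ), ∃ t ≥ (0:ℝ), ∀ d : ℕ, 0 < d → ∀ ε ∈ Set.Ioo (0:ℝ) 1,
    (nc d ε : ℝ) ≤ C * Real.exp (t * (1 + Real.log d) * (1 + Real.log (Real.log ε⁻¹ + 1)))

/-- The exponent of exponential quasi-polynomial tractability. -/
def EXPQPTexp (nc : ℕ → ℝ → ℕ) : ℝ :=
  sInf {t : ℝ | 0 ≤ t ∧ ∃ C > (0:ℝ), ∀ d : ℕ, 0 < d → ∀ ε ∈ Set.Ioo (0:ℝ) 1,
    (nc d ε : ℝ) ≤ C * Real.exp (t * (1 + Real.log d) * (1 + Real.log (Real.log ε⁻¹ + 1)))}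

/-- `lim_{ε⁻¹ + d → ∞} (log nc(d, ε)) / den(d, ε) = 0`. -/
def WTlim (den : ℕ → ℝ → ℝ) (nc : ℕ → ℝ → ℕ) : Prop :=
  ∀ δ > (0:ℝ), ∃ M : ℝ, ∀ d : ℕ, 0 < d → ∀ ε ∈ Set.Ioo (0:ℝ) 1,
    M ≤ ε⁻¹ + d → |Real.log (nc d ε) / den d ε| < δ

/-- Algebraic `(s,t)`-weak tractability; `ALGWTst 1 1` is algebraic weak tractability. -/
def ALGWTst (s t : ℝ) (nc : ℕ → ℝ → ℕ) : Prop :=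
  WTlim (fun d ε => ε ^ (-s) + (d : ℝ) ^ t) nc

/-- Algebraic uniform weak tractability. -/
def ALGUWT (nc : ℕ → ℝ → ℕ) : Prop := ∀ α > (0:ℝ), ∀ β > (0:ℝ), ALGWTst α β nc

/-- Exponential `(s,t)`-weak tractability; `EXPWTst 1 1` is exponential weak tractability. -/
def EXPWTst (s t : ℝ) (nc : ℕ → ℝ → ℕ) : Prop :=
  WTlim (fun d ε => (1 + Real.log ε⁻¹) ^ s + (d : ℝ) ^ t) nc

/-- Exponential uniform weak tractability. -/
def EXPUWT (nc : ℕ → ℝ → ℕ) : Prop := ∀ α > (0:ℝ), ∀ β > (0:ℝ), EXPWTst α β nc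

/-- `ln₊ x = max(1, ln x)`. -/
def lnplus (x : ℝ) : ℝ := max 1 (Real.log x)

/-- The weight `ω` of the weighted Korobov space `H(K_{d,r,g})`, i.e.
`ω(h) = √(ρ_{d,r,g}(h))` with `ρ_{d,r,g}(h) = ∏_j τ_j(h_j)`, `τ_j(0) = 1` and
`τ_j(h) = g_j⁻¹ |h|^{2 r_j}` for `h ≠ 0` (coordinate `j` uses `g_{j+1}, r_{j+1}`,
the sequences being indexed starting from `1`). -/
def korWeight (g r : ℕ → ℝ) (d : ℕ) (h : Fin d → ℤ) : ℝ :=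
  Real.sqrt (∏ j : Fin d,
    if h j = 0 then 1 else (g (j.1 + 1))⁻¹ * (|h j| : ℝ) ^ (2 * r (j.1 + 1)))

/-- The information complexity function of `L_∞`-approximation over the weighted Korobov
spaces, for the class `Λ^std` (`useStd = true`) or `Λ^all` (`useStd = false`). -/
def korNC (g r : ℕ → ℝ) (useStd : Bool) (crit : Crit) : ℕ → ℝ → ℕ := fun d ε =>
  infoComp (korWeight g r d) (if useStd then stdInfo (korWeight g r d) else allInfo d) crit ε



lemma kr_exp_norm {d : ℕ} (k : Fin d → ℤ) (x : Fin d → ℝ) :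
    ‖Complex.exp (2 * Real.pi * Complex.I * ∑ j, (k j : ℂ) * (x j : ℂ))‖ = 1 := by
  have : (2 * Real.pi * Complex.I * ∑ j, (k j : ℂ) * (x j : ℂ)) =
      ((2 * Real.pi * ∑ j, (k j : ℝ) * x j : ℝ) : ℂ) * Complex.I := by
    push_cast; ring
  rw [this, Complex.norm_exp_ofReal_mul_I]

/-- Representer of point evaluation. -/
def avec {d : ℕ} (ω : (Fin d → ℤ) → ℝ) (hs : Summable fun k => ((ω k)⁻¹) ^ 2)
    (x : Fin d → ℝ) : Coef d :=
  ⟨fun k => ((ω k : ℂ))⁻¹ *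
      (starRingEnd ℂ) (Complex.exp (2 * Real.pi * Complex.I * ∑ j, (k j : ℂ) * (x j : ℂ))), by
    refine (memℓp_gen_iff (by norm_num)).2 ?_
    refine hs.congr fun k => ?_
    simp [kr_exp_norm]⟩

lemma avec_apply_norm {d : ℕ} (ω : (Fin d → ℤ) → ℝ) (hs : Summable fun k => ((ω k)⁻¹) ^ 2)
    (x : Fin d → ℝ) (k : Fin d → ℤ) : ‖avec ω hs x k‖ ^ 2 = ((ω k)⁻¹) ^ 2 := by
  show ‖((ω k : ℂ))⁻¹ *
      (starRingEnd ℂ) (Complex.exp (2 * Real.pi * Complex.I * ∑ j, (k j : ℂ) * (x j : ℂ)))‖ ^ 2 = _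
  simp [kr_exp_norm]

lemma torusFn_eq {d : ℕ} (ω : (Fin d → ℤ) → ℝ) (hs : Summable fun k => ((ω k)⁻¹) ^ 2)
    (u : Coef d) (x : Fin d → ℝ) : torusFn ω u x = inner ℂ (avec ω hs x) u := by
  rw [lp.inner_eq_tsum]
  unfold torusFn
  congr 1
  ext k
  show _ = inner ℂ (((ω k : ℂ))⁻¹ *
      (starRingEnd ℂ) (Complex.exp (2 * Real.pi * Complex.I * ∑ j, (k j : ℂ) * (x j : ℂ)))) (u k)
  rw [RCLike.inner_apply]
  simp only [map_mul, map_inv₀, Complex.conj_ofReal, Complex.conj_conj]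
  ring

lemma lp_norm_sq {d : ℕ} (u : Coef d) : ‖u‖ ^ 2 = ∑' k, ‖u k‖ ^ 2 := by
  have := lp.norm_rpow_eq_tsum (p := 2) (by norm_num) u
  simpa using this

lemma avec_norm_sq {d : ℕ} (ω : (Fin d → ℤ) → ℝ) (hs : Summable fun k => ((ω k)⁻¹) ^ 2)
    (x : Fin d → ℝ) : ‖avec ω hs x‖ ^ 2 = ∑' k, ((ω k)⁻¹) ^ 2 := by
  rw [lp_norm_sq]
  exact tsum_congr fun k => avec_apply_norm ω hs x k

lemma initErr_le {d : ℕ} (ω : (Fin d → ℤ) → ℝ) (hs : Summable fun k => ((ω k)⁻¹) ^ 2) :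
    initErr ω ≤ ENNReal.ofReal (Real.sqrt (∑' k, ((ω k)⁻¹) ^ 2)) := by
  unfold initErr
  refine iSup₂_le fun u hu => iSup₂_le fun x hx => ?_
  rw [← enorm_eq_nnnorm, ← ofReal_norm]
  apply ENNReal.ofReal_le_ofReal
  rw [torusFn_eq ω hs, ← avec_norm_sq ω hs x, Real.sqrt_sq (norm_nonneg _)]
  calc _ ≤ ‖avec ω hs x‖ * ‖u‖ := norm_inner_le_norm _ _
    _ ≤ _ := mul_le_of_le_one_right (norm_nonneg _) hu

lemma one_le_initErr {d : ℕ} (ω : (Fin d → ℤ) → ℝ) (h0 : ω 0 = 1) : 1 ≤ initErr ω := by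
  classical
  unfold initErr
  refine le_iSup₂_of_le (lp.single 2 (0 : Fin d → ℤ) (1:ℂ)) (by rw [lp.norm_single] <;> simp) ?_
  refine le_iSup₂_of_le 0 (by intro j; simp) ?_
  rw [← enorm_eq_nnnorm, ← ofReal_norm]
  unfold torusFn
  rw [tsum_eq_single 0]
  · simp [h0]
  · intro k hk
    rw [lp.single_apply_ne _ _ _ hk]
    simp

lemma std_sub_all {d : ℕ} (ω : (Fin d → ℤ) → ℝ) (hs : Summable fun k => ((ω k)⁻¹) ^ 2) :
    stdInfo ω ⊆ allInfo d := by
  rintro L ⟨x, hx, rfl⟩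
  refine ⟨innerSL ℂ (avec ω hs x), ?_⟩
  ext u
  rw [torusFn_eq ω hs]; rfl

lemma wcErr_mono {d : ℕ} (ω : (Fin d → ℤ) → ℝ) {A B : Set (Coef d → ℂ)} (h : A ⊆ B) (n : ℕ) :
    wcErr ω B n ≤ wcErr ω A n := by
  unfold wcErr
  exact iInf_mono fun L => iInf_mono' fun hL => ⟨fun i => h (hL i), le_rfl⟩

/-- If the span of representers approximates all representers, the error is small. -/
lemma wcErr_std_le {d : ℕ} (ω : (Fin d → ℤ) → ℝ) (hs : Summable fun k => ((ω k)⁻¹) ^ 2)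
    (n : ℕ) (y : Fin n → Fin d → ℝ) (hy : ∀ i, y i ∈ cube d) (ε : ℝ)
    (h : ∀ x ∈ cube d, ∃ v ∈ Submodule.span ℂ (Set.range fun i => avec ω hs (y i)),
      ‖avec ω hs x - v‖ ≤ ε) :
    wcErr ω (stdInfo ω) n ≤ ENNReal.ofReal ε := by
  have h' : ∀ x, ∃ c : Fin n → ℂ, x ∈ cube d →
      ‖avec ω hs x - ∑ i, c i • avec ω hs (y i)‖ ≤ ε := by
    intro x
    by_cases hx : x ∈ cube d
    · obtain ⟨v, hv, hv2⟩ := h x hx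
      obtain ⟨c, rfl⟩ := (Submodule.mem_span_range_iff_exists_fun ℂ).1 hv
      exact ⟨c, fun _ => hv2⟩
    · exact ⟨0, fun h => absurd h hx⟩
  choose c hc using h'
  unfold wcErr
  refine iInf₂_le_of_le (fun i u => torusFn ω u (y i)) (fun i => ⟨y i, hy i, rfl⟩) ?_
  refine iInf_le_of_le (fun b x => ∑ i, (starRingEnd ℂ) (c x i) * b i) ?_
  refine iSup₂_le fun u hu => iSup₂_le fun x hx => ?_
  rw [← enorm_eq_nnnorm, ← ofReal_norm]
  apply ENNReal.ofReal_le_ofReal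
  have : torusFn ω u x - ∑ i, (starRingEnd ℂ) (c x i) * torusFn ω u (y i) =
      inner ℂ (avec ω hs x - ∑ i, c x i • avec ω hs (y i)) u := by
    simp only [torusFn_eq ω hs, inner_sub_left, sum_inner, inner_smul_left]
  rw [this]
  calc _ ≤ ‖avec ω hs x - ∑ i, c x i • avec ω hs (y i)‖ * ‖u‖ := norm_inner_le_norm _ _
    _ ≤ ‖avec ω hs x - ∑ i, c x i • avec ω hs (y i)‖ := mul_le_of_le_one_right (norm_nonneg _) hu
    _ ≤ ε := hc x hx

lemma greedy_orth {H : Type*} [NormedAddCommGroup H] [InnerProductSpace ℂ H]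
    (A : Set H) (ε : ℝ) (hε : 0 ≤ ε) (N : ℕ)
    (h : ∀ F : Finset H, (F : Set H) ⊆ A → F.card ≤ N →
      ∃ a ∈ A, ∀ v ∈ Submodule.span ℂ (F : Set H), ε < ‖a - v‖) :
    ∃ a q : Fin N → H, (∀ i, a i ∈ A) ∧ Orthonormal ℂ q ∧ ∀ i, ε < ‖inner ℂ (q i) (a i)‖ := by
  classical
  have h' : ∀ F : Finset H, ∃ a, (F : Set H) ⊆ A → F.card ≤ N →
      a ∈ A ∧ ∀ v ∈ Submodule.span ℂ (F : Set H), ε < ‖a - v‖ := by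
    intro F
    by_cases h1 : (F : Set H) ⊆ A ∧ F.card ≤ N
    · obtain ⟨a, ha⟩ := h F h1.1 h1.2
      exact ⟨a, fun _ _ => ha⟩
    · exact ⟨0, fun h2 h3 => absurd ⟨h2, h3⟩ h1⟩
  choose pick hpick using h'
  obtain ⟨F, hF0, hFs⟩ : ∃ F : ℕ → Finset H, F 0 = ∅ ∧
      ∀ n, F (n+1) = insert (pick (F n)) (F n) :=
    ⟨fun n => Nat.rec ∅ (fun _ F => insert (pick F) F) n, rfl, fun n => rfl⟩
  have hF : ∀ n : ℕ, n ≤ N → ((F n : Finset H) : Set H) ⊆ A ∧ (F n).card ≤ n := by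
    intro n
    induction n with
    | zero => intro _; simp [hF0]
    | succ n ih =>
      intro hn
      obtain ⟨h1, h2⟩ := ih (by omega)
      rw [hFs]
      refine ⟨?_, (Finset.card_insert_le _ _).trans (by omega)⟩
      rw [Finset.coe_insert, Set.insert_subset_iff]
      exact ⟨(hpick _ h1 (by omega)).1, h1⟩
  have hmono : Monotone F := monotone_nat_of_le_succ fun n => by
    rw [hFs]; exact Finset.subset_insert (pick (F n)) (F n)
  let V : ℕ → Submodule ℂ H := fun n => Submodule.span ℂ (F n : Set H)
  have hVfin : ∀ n, FiniteDimensional ℂ (V n) := fun n =>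
    FiniteDimensional.span_of_finite ℂ (F n).finite_toSet
  have hVmono : Monotone V := fun m n hmn => Submodule.span_mono (by exact_mod_cast hmono hmn)
  let a : ℕ → H := fun n => pick (F n)
  let r : ℕ → H := fun n => a n - (V n).starProjection (a n)
  have haV : ∀ n, a n ∈ V (n+1) := fun n => Submodule.subset_span (by
    rw [hFs]; simp [a])
  have hrV : ∀ n, r n ∈ V (n+1) := fun n => Submodule.sub_mem _ (haV n)
    (hVmono (Nat.le_succ n) (Submodule.starProjection_apply_mem _ _))
  have hro : ∀ n, ∀ w ∈ V n, inner ℂ (r n) w = 0 := fun n w hw =>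
    Submodule.starProjection_inner_eq_zero _ _ hw
  have hrn : ∀ n, n < N → ε < ‖r n‖ := fun n hn =>
    (hpick _ (hF n hn.le).1 ((hF n hn.le).2.trans hn.le)).2 _ (Submodule.starProjection_apply_mem _ _)
  refine ⟨fun i => a i, fun i => ((‖r i‖ : ℂ))⁻¹ • r i, ?_, ⟨?_, ?_⟩, ?_⟩
  · intro i
    exact (hpick _ (hF i i.2.le).1 ((hF i i.2.le).2.trans i.2.le)).1
  · intro i
    have := hε.trans_lt (hrn i i.2)
    rw [norm_smul]
    simp [this.ne']
  · have key : ∀ i j : ℕ, i < j → inner ℂ (r j) (r i) = 0 := fun i j hij =>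
      hro j _ (hVmono hij (hrV i))
    intro i j hij
    simp only [inner_smul_left, inner_smul_right]
    rcases lt_or_gt_of_ne (fun h => hij (Fin.ext h)) with h1 | h1
    · rw [← inner_conj_symm, key _ _ h1]; simp
    · rw [key _ _ h1]; simp
  · intro i
    have hpos := hε.trans_lt (hrn i i.2)
    have h1 : inner ℂ (r i) (a i) = ((‖r i‖ : ℂ)) ^ 2 := by
      have : a i = r i + (V i).starProjection (a i) := by simp [r]
      rw [this]
      rw [inner_add_right, hro i _ (Submodule.starProjection_apply_mem _ _), add_zero,
        inner_self_eq_norm_sq_to_K]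
      rfl
    rw [inner_smul_left, h1]
    simp only [map_inv₀, Complex.conj_ofReal, norm_mul, norm_inv, norm_pow, Complex.norm_real,
      norm_norm]
    have : ‖r i‖⁻¹ * ‖r i‖ ^ 2 = ‖r i‖ := by field_simp
    rw [this]; exact hrn i i.2

lemma bessel_coord {d N : ℕ} (q : Fin N → Coef d) (hq : Orthonormal ℂ q) (k : Fin d → ℤ) :
    ∑ i, ‖q i k‖ ^ 2 ≤ 1 := by
  classical
  have := hq.sum_inner_products_le (x := lp.single 2 k (1:ℂ)) (s := Finset.univ)
  rw [lp.norm_single (by norm_num)] at this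
  simpa [lp.inner_single_right] using this

lemma split_bound {d : ℕ} (a q : Coef d) (hq : ‖q‖ ≤ 1) (S : Finset (Fin d → ℤ)) (T : ℝ)
    (hT : ∀ U : Finset (Fin d → ℤ), Disjoint U S → ∑ k ∈ U, ‖a k‖ ^ 2 ≤ T) :
    ‖inner ℂ q a‖ ^ 2 ≤ 2 * ((‖a‖ ^ 2) * ∑ k ∈ S, ‖q k‖ ^ 2) + 2 * T := by
  classical
  set b : Coef d := ∑ k ∈ S, lp.single 2 k (a k) with hb
  have hsa : Summable fun k => ‖a k‖ ^ 2 := by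
    have := (lp.memℓp a).summable (by norm_num)
    simpa using this
  have hbk : ∀ k, b k = if k ∈ S then a k else 0 := by
    intro k
    rw [hb, lp.coeFn_sum, Finset.sum_apply]
    simp only [lp.coeFn_single, Pi.single_apply]
    simp
  have h1 : ‖a - b‖ ^ 2 ≤ T := by
    rw [lp_norm_sq]
    have hs : Summable fun k => ‖(a - b) k‖ ^ 2 := by
      have := (lp.memℓp (a - b)).summable (by norm_num)
      simpa using this
    refine hs.tsum_le_of_sum_le fun U => ?_
    refine le_trans ?_ (hT (U \ S) Finset.sdiff_disjoint)
    have : ∀ k, ‖(a - b) k‖ ^ 2 = if k ∈ S then 0 else ‖a k‖ ^ 2 := by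
      intro k
      rw [lp.coeFn_sub, Pi.sub_apply, hbk]
      split_ifs <;> simp
    simp only [this]
    rw [Finset.sum_ite, Finset.sum_const_zero, zero_add, Finset.filter_notMem_eq_sdiff]
  have h2 : ‖inner ℂ q b‖ ^ 2 ≤ (‖a‖ ^ 2) * ∑ k ∈ S, ‖q k‖ ^ 2 := by
    have e : inner ℂ q b = ∑ k ∈ S, inner ℂ (q k) (a k) := by
      rw [hb, inner_sum]
      simp only [lp.inner_single_right]
    have e2 : ‖inner ℂ q b‖ ≤ ∑ k ∈ S, ‖a k‖ * ‖q k‖ := by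
      rw [e]
      refine (norm_sum_le _ _).trans (Finset.sum_le_sum fun k _ => ?_)
      rw [mul_comm]
      exact norm_inner_le_norm _ _
    calc _ ≤ (∑ k ∈ S, ‖a k‖ * ‖q k‖) ^ 2 := by gcongr
      _ ≤ (∑ k ∈ S, ‖a k‖ ^ 2) * ∑ k ∈ S, ‖q k‖ ^ 2 := Finset.sum_mul_sq_le_sq_mul_sq _ _ _
      _ ≤ _ := by
        gcongr
        rw [lp_norm_sq]
        exact hsa.sum_le_tsum _ fun k _ => by positivity
  have h3 : ‖inner ℂ q (a - b)‖ ^ 2 ≤ T := by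
    refine le_trans ?_ h1
    gcongr
    calc _ ≤ ‖q‖ * ‖a - b‖ := norm_inner_le_norm _ _
      _ ≤ _ := mul_le_of_le_one_left (norm_nonneg _) hq
  have h4 : ‖inner ℂ q a‖ ≤ ‖inner ℂ q b‖ + ‖inner ℂ q (a - b)‖ := by
    have : inner ℂ q a = inner ℂ q b + inner ℂ q (a - b) := by
      rw [← inner_add_right]; congr 1; abel
    rw [this]; exact norm_add_le _ _
  have h5 : ‖inner ℂ q a‖ ^ 2 ≤ (‖inner ℂ q b‖ + ‖inner ℂ q (a - b)‖) ^ 2 := by gcongr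
  nlinarith [sq_nonneg (‖inner ℂ q b‖ - ‖inner ℂ q (a - b)‖)]

/-- Main upper bound for standard information. -/
lemma wcErr_std_bound {d : ℕ} (ω : (Fin d → ℤ) → ℝ) (hs : Summable fun k => ((ω k)⁻¹) ^ 2)
    (S : Finset (Fin d → ℤ)) (T ε : ℝ) (hε : 0 ≤ ε)
    (hT : ∀ U : Finset (Fin d → ℤ), Disjoint U S → ∑ k ∈ U, ((ω k)⁻¹) ^ 2 ≤ T) (N : ℕ)
    (hN : 2 * (∑' k, ((ω k)⁻¹) ^ 2) * S.card + 2 * N * T < N * ε ^ 2) :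
    wcErr ω (stdInfo ω) N ≤ ENNReal.ofReal ε := by
  classical
  by_contra hcon
  have hg := greedy_orth (avec ω hs '' cube d) ε hε N (by
    intro F hF hc
    by_contra! h
    apply hcon
    have h0 : (0 : Fin d → ℝ) ∈ cube d := by intro j; simp
    obtain ⟨y, hy⟩ : ∃ y : Fin N → Fin d → ℝ, (∀ i, y i ∈ cube d) ∧
        (F : Set (Coef d)) ⊆ Set.range fun i => avec ω hs (y i) := by
      have : ∀ a : F, ∃ x ∈ cube d, avec ω hs x = a := fun a => hF a.2
      choose x hx hxa using this
      let e := F.equivFin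
      refine ⟨fun i => if h : i.1 < F.card then x (e.symm ⟨i.1, h⟩) else 0, ?_, ?_⟩
      · intro i
        dsimp only
        split_ifs
        · exact hx _
        · exact h0
      · intro a ha
        refine ⟨⟨(e ⟨a, ha⟩).1, (e ⟨a, ha⟩).2.trans_le hc⟩, ?_⟩
        simp [hxa]
    refine wcErr_std_le ω hs N y hy.1 ε fun x hx => ?_
    obtain ⟨v, hv, hv2⟩ := h _ ⟨x, hx, rfl⟩
    exact ⟨v, Submodule.span_mono hy.2 hv, hv2⟩)
  obtain ⟨a, q, ha, hq, hlt⟩ := hg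
  set Λ := ∑' k, ((ω k)⁻¹) ^ 2
  have hΛ : 0 ≤ Λ := tsum_nonneg fun k => by positivity
  have h1 : ∀ i, ε ^ 2 ≤ 2 * (Λ * ∑ k ∈ S, ‖q i k‖ ^ 2) + 2 * T := by
    intro i
    obtain ⟨x, hx, hxa⟩ := ha i
    have := split_bound (a i) (q i) (hq.1 i).le S T (by
      intro U hU
      rw [← hxa]
      simp only [avec_apply_norm]
      exact hT U hU)
    rw [← hxa, avec_norm_sq] at this
    refine le_trans ?_ this
    rw [hxa]
    have := hlt i
    gcongr
  have h2 : (N : ℝ) * ε ^ 2 ≤ ∑ i : Fin N, (2 * (Λ * ∑ k ∈ S, ‖q i k‖ ^ 2) + 2 * T) := by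
    have := Finset.sum_le_sum fun i (_ : i ∈ (Finset.univ : Finset (Fin N))) => h1 i
    simpa using this
  have h3 : ∑ i : Fin N, ∑ k ∈ S, ‖q i k‖ ^ 2 ≤ S.card := by
    rw [Finset.sum_comm]
    calc _ ≤ ∑ k ∈ S, (1:ℝ) := Finset.sum_le_sum fun k _ => bessel_coord q hq k
      _ = _ := by simp
  rw [Finset.sum_add_distrib, ← Finset.mul_sum, ← Finset.mul_sum] at h2
  simp only [Finset.sum_const, Finset.card_univ, Fintype.card_fin, nsmul_eq_mul] at h2
  have h4 := mul_le_mul_of_nonneg_left h3 hΛ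
  nlinarith

lemma grid_orth {d : ℕ} (M : ℕ) (hM : 0 < M) (k l : Fin d → ℤ)
    (hkl : ∀ j, |k j - l j| < M) :
    ∑ p : Fin d → Fin M,
      Complex.exp (2 * Real.pi * Complex.I * ∑ j, (k j : ℂ) * (((p j : ℝ) / M : ℝ) : ℂ)) *
      (starRingEnd ℂ) (Complex.exp (2 * Real.pi * Complex.I *
        ∑ j, (l j : ℂ) * (((p j : ℝ) / M : ℝ) : ℂ))) = if k = l then (M : ℂ) ^ d else 0 := by
  have hM' : (M : ℂ) ≠ 0 := by exact_mod_cast hM.ne'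
  have e1 : ∀ p : Fin d → Fin M,
      Complex.exp (2 * Real.pi * Complex.I * ∑ j, (k j : ℂ) * (((p j : ℝ) / M : ℝ) : ℂ)) *
      (starRingEnd ℂ) (Complex.exp (2 * Real.pi * Complex.I *
        ∑ j, (l j : ℂ) * (((p j : ℝ) / M : ℝ) : ℂ))) =
      ∏ j, (Complex.exp (2 * Real.pi * Complex.I * ((k j - l j : ℤ) : ℂ) / M)) ^ ((p j : ℕ)) := by
    intro p
    simp only [← Complex.exp_nat_mul]
    rw [← Complex.exp_conj, ← Complex.exp_add, ← Complex.exp_sum]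
    congr 1
    simp only [map_mul, map_sum, Complex.conj_I, Complex.conj_ofReal, map_ofNat,
      map_intCast]
    rw [Finset.mul_sum, Finset.mul_sum, ← Finset.sum_add_distrib]
    refine Finset.sum_congr rfl fun j _ => ?_
    push_cast
    field_simp
    ring
  simp only [e1]
  have e2 := Finset.prod_univ_sum (fun _ : Fin d => (Finset.univ : Finset (Fin M)))
    (fun j p => (Complex.exp (2 * Real.pi * Complex.I * ((k j - l j : ℤ) : ℂ) / M)) ^ ((p : ℕ)))
  rw [Fintype.piFinset_univ] at e2
  rw [← e2]
  split_ifs with h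
  · subst h
    simp
  · obtain ⟨j, hj⟩ := Function.ne_iff.1 h
    refine Finset.prod_eq_zero (Finset.mem_univ j) ?_
    set w := Complex.exp (2 * Real.pi * Complex.I * ((k j - l j : ℤ) : ℂ) / M) with hw
    have hw1 : w ≠ 1 := by
      intro h1
      rw [hw, Complex.exp_eq_one_iff] at h1
      obtain ⟨n, hn⟩ := h1
      have hpi : (2 * Real.pi * Complex.I : ℂ) ≠ 0 := Complex.two_pi_I_ne_zero
      have h2 : ((k j - l j : ℤ) : ℂ) = n * M := by
        field_simp at hn
        have : (2 * Real.pi * Complex.I : ℂ) * ((k j - l j : ℤ) : ℂ) =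
          (2 * Real.pi * Complex.I : ℂ) * (n * M) := by linear_combination (2 * Real.pi * Complex.I : ℂ) * hn
        exact mul_left_cancel₀ hpi this
      have h3 : k j - l j = n * M := by exact_mod_cast h2
      have h4 := hkl j
      have h5 : k j - l j ≠ 0 := sub_ne_zero.2 hj
      have : n ≠ 0 := by rintro rfl; simp at h3; exact h5 (by omega)
      rw [h3, abs_mul, Nat.abs_cast] at h4
      have : 1 ≤ |n| := Int.one_le_abs this
      have : (0:ℤ) < M := by exact_mod_cast hM
      nlinarith
    have hwM : w ^ M = 1 := by
      rw [hw, ← Complex.exp_nat_mul, Complex.exp_eq_one_iff]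
      refine ⟨k j - l j, ?_⟩
      field_simp
    rw [Fin.sum_univ_eq_sum_range (fun i => w ^ i), geom_sum_eq hw1, hwM]
    simp

lemma gen_parseval {ι P : Type*} [Fintype ι] [DecidableEq ι] [Fintype P] (E : ι → P → ℂ) (D : ℝ)
    (h : ∀ k l, ∑ p, E k p * (starRingEnd ℂ) (E l p) = if k = l then (D : ℂ) else 0) (c : ι → ℂ) :
    ∑ p, ‖∑ k, c k * E k p‖ ^ 2 = D * ∑ k, ‖c k‖ ^ 2 := by
  apply Complex.ofReal_injective
  push_cast
  simp only [← Complex.mul_conj', map_sum, map_mul, Finset.sum_mul_sum]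
  rw [Finset.sum_comm, Finset.mul_sum]
  refine Finset.sum_congr rfl fun k _ => ?_
  rw [Finset.sum_comm]
  have : ∀ l, ∑ p, c k * E k p * ((starRingEnd ℂ) (c l) * (starRingEnd ℂ) (E l p)) =
      c k * (starRingEnd ℂ) (c l) * (if k = l then (D : ℂ) else 0) := by
    intro l
    rw [← h k l, Finset.mul_sum]
    exact Finset.sum_congr rfl fun p _ => by ring
  simp only [this]
  simp
  ring

lemma grid_parseval {d : ℕ} (S : Finset (Fin d → ℤ)) : ∃ M : ℕ, 0 < M ∧ ∀ c : S → ℂ,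
    ∑ p : Fin d → Fin M, ‖∑ k : S, c k * Complex.exp (2 * Real.pi * Complex.I *
      ∑ j, (k.1 j : ℂ) * (((p j : ℝ) / M : ℝ) : ℂ))‖ ^ 2 = (M : ℝ) ^ d * ∑ k : S, ‖c k‖ ^ 2 := by
  classical
  refine ⟨2 * (∑ k ∈ S, ∑ j, (k j).natAbs) + 1, by omega, fun c => ?_⟩
  set M := 2 * (∑ k ∈ S, ∑ j, (k j).natAbs) + 1
  have hb : ∀ k ∈ S, ∀ j, (k j).natAbs ≤ ∑ k ∈ S, ∑ j, (k j).natAbs := fun k hk j =>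
    (Finset.single_le_sum (f := fun j => (k j).natAbs) (fun _ _ => Nat.zero_le _)
      (Finset.mem_univ j)).trans
    (Finset.single_le_sum (f := fun k : Fin d → ℤ => ∑ j, (k j).natAbs)
      (fun _ _ => Nat.zero_le _) hk)
  have horth := fun k l : S => grid_orth M (by omega) k.1 l.1 (by
    intro j
    have h1 := hb k k.2 j
    have h2 := hb l l.2 j
    rw [abs_lt]
    constructor <;> omega)
  refine gen_parseval (fun (k : S) (p : Fin d → Fin M) => Complex.exp (2 * Real.pi * Complex.I *
      ∑ j, (k.1 j : ℂ) * (((p j : ℝ) / M : ℝ) : ℂ))) ((M : ℝ) ^ d) (fun k l => ?_) c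
  have h1 := horth k l
  rw [h1]
  by_cases h : k = l
  · rw [if_pos h, if_pos (congrArg Subtype.val h)]; push_cast; rfl
  · rw [if_neg h, if_neg (fun h' => h (Subtype.ext h'))]

lemma wcErr_all_lower {d : ℕ} (ω : (Fin d → ℤ) → ℝ) (n : ℕ) (S : Finset (Fin d → ℤ))
    (μ : (Fin d → ℤ) → ℝ) (B : ℝ) (hμ : ∀ k ∈ S, μ k ≤ ((ω k)⁻¹) ^ 2)
    (hμB : ∀ k ∈ S, μ k ≤ B) (hB : 0 ≤ B) :
    ENNReal.ofReal (Real.sqrt (∑ k ∈ S, μ k - n * B)) ≤ wcErr ω (allInfo d) n := by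
  classical
  unfold wcErr
  refine le_iInf₂ fun L hL => le_iInf fun φ => ?_
  choose Lc hLc using hL
  let T : EuclideanSpace ℂ S →ₗ[ℂ] Coef d :=
    ∑ k : S, (lp.lsingle (𝕜 := ℂ) 2 k.1).comp (EuclideanSpace.proj (𝕜 := ℂ) k).toLinearMap
  have hT : ∀ v : EuclideanSpace ℂ S, T v = ∑ k : S, lp.single 2 k.1 (v k) := by
    intro v
    simp only [T, LinearMap.sum_apply]
    rfl
  have hTk : ∀ (v : EuclideanSpace ℂ S) (k : S), T v k.1 = v k := by
    intro v k
    rw [hT, lp.coeFn_sum, Finset.sum_apply]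
    rw [Finset.sum_eq_single k]
    · simp
    · intro l _ hl
      exact lp.single_apply_ne _ _ _ (fun h => hl (Subtype.ext h.symm))
    · simp
  have hTk' : ∀ (v : EuclideanSpace ℂ S) (k), k ∉ S → T v k = 0 := by
    intro v k hk
    rw [hT, lp.coeFn_sum, Finset.sum_apply]
    refine Finset.sum_eq_zero fun l _ => ?_
    exact lp.single_apply_ne _ _ _ (fun h => hk (h ▸ l.2))
  have hTn : ∀ v : EuclideanSpace ℂ S, ‖T v‖ ^ 2 = ‖v‖ ^ 2 := by
    intro v
    rw [lp_norm_sq, EuclideanSpace.norm_sq_eq, tsum_eq_sum (s := S), ← Finset.sum_coe_sort]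
    · simp only [hTk]
    · intro k hk; simp [hTk' v k hk]
  have hf : ∀ (v : EuclideanSpace ℂ S) x, torusFn ω (T v) x = ∑ k : S, ((ω k : ℂ)⁻¹ * v k) *
      Complex.exp (2 * Real.pi * Complex.I * ∑ j, (k.1 j : ℂ) * (x j : ℂ)) := by
    intro v x
    unfold torusFn
    rw [tsum_eq_sum (s := S), ← Finset.sum_coe_sort]
    · simp only [hTk]
    · intro k hk; simp [hTk' v k hk]
  let Φ : EuclideanSpace ℂ S →ₗ[ℂ] (Fin n → ℂ) := LinearMap.pi fun i => (Lc i).toLinearMap.comp T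
  let W := LinearMap.ker Φ
  have hW : ∀ v ∈ W, ∀ i, L i (T v) = 0 := by
    intro v hv i
    rw [hLc i]
    exact congrFun (LinearMap.mem_ker.1 hv) i
  let m := Module.finrank ℂ W
  have hm : S.card ≤ m + n := by
    have h1 := LinearMap.finrank_range_add_finrank_ker Φ
    have h2 : Module.finrank ℂ (LinearMap.range Φ) ≤ n := by
      simpa using Submodule.finrank_le (LinearMap.range Φ)
    have h3 : Module.finrank ℂ (EuclideanSpace ℂ S) = S.card := by simp
    rw [h3] at h1
    show S.card ≤ Module.finrank ℂ (LinearMap.ker Φ) + n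
    omega
  let b := stdOrthonormalBasis ℂ W
  let v : Fin m → EuclideanSpace ℂ S := fun i => (b i : EuclideanSpace ℂ S)
  have hv : Orthonormal ℂ v := b.orthonormal.comp_linearIsometry W.subtypeₗᵢ
  have hvW : ∀ i, v i ∈ W := fun i => (b i).2
  obtain ⟨M, hM, hpar⟩ := grid_parseval S
  let pt : (Fin d → Fin M) → Fin d → ℝ := fun p j => (p j : ℝ) / M
  have hpt : ∀ p, pt p ∈ cube d := by
    intro p j
    have h1 : ((p j : ℕ) : ℝ) ≤ M := by exact_mod_cast (p j).2.le
    have hM' : (0:ℝ) < M := by exact_mod_cast hM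
    exact ⟨by positivity, (div_le_one hM').2 h1⟩
  let f : Fin m → (Fin d → ℝ) → ℂ := fun i x => torusFn ω (T (v i)) x
  let R : (Fin d → ℝ) → ℝ := fun x => ∑ i, ‖f i x‖ ^ 2
  set Q := ∑ k ∈ S, μ k - n * B with hQ
  -- average
  have havg : (M : ℝ) ^ d * Q ≤ ∑ p, R (pt p) := by
    simp only [R]
    rw [Finset.sum_comm]
    have h1 : ∀ i, ∑ p, ‖f i (pt p)‖ ^ 2 =
        (M : ℝ) ^ d * ∑ k : S, ‖(ω k : ℂ)⁻¹ * v i k‖ ^ 2 := by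
      intro i
      rw [← hpar]
      refine Finset.sum_congr rfl fun p _ => ?_
      simp only [f, hf, pt]
    simp only [h1]
    rw [← Finset.mul_sum]
    gcongr
    rw [Finset.sum_comm]
    have hc : ∀ k : S, ∑ i, ‖v i k‖ ^ 2 ≤ 1 := by
      intro k
      have := hv.sum_inner_products_le (x := EuclideanSpace.single k (1:ℂ)) (s := Finset.univ)
      simpa [EuclideanSpace.inner_single_right] using this
    have hcs : ∑ k : S, ∑ i, ‖v i k‖ ^ 2 = m := by
      rw [Finset.sum_comm]
      have : ∀ i, ∑ k : S, ‖v i k‖ ^ 2 = 1 := by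
        intro i
        rw [← EuclideanSpace.norm_sq_eq, hv.1 i]; norm_num
      rw [Finset.sum_congr rfl fun i _ => this i]
      simp
    have h2 : ∀ k : S, μ k - B * (1 - ∑ i, ‖v i k‖ ^ 2) ≤
        ∑ i, ‖(ω k : ℂ)⁻¹ * v i k‖ ^ 2 := by
      intro k
      have e : ∑ i, ‖(ω k : ℂ)⁻¹ * v i k‖ ^ 2 = ((ω k)⁻¹) ^ 2 * ∑ i, ‖v i k‖ ^ 2 := by
        rw [Finset.mul_sum]
        refine Finset.sum_congr rfl fun i _ => ?_
        rw [norm_mul, mul_pow]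
        simp
      rw [e]
      have h3 := hc k
      have h4 : 0 ≤ ∑ i, ‖v i k‖ ^ 2 := Finset.sum_nonneg fun i _ => by positivity
      nlinarith [mul_le_mul_of_nonneg_right (hμ k k.2) h4,
        mul_le_mul_of_nonneg_right (hμB k k.2) (sub_nonneg.2 h3)]
    refine le_trans ?_ (Finset.sum_le_sum fun k _ => h2 k)
    rw [Finset.sum_sub_distrib, ← Finset.mul_sum, Finset.sum_sub_distrib, hcs,
      Finset.sum_coe_sort S μ]
    simp only [Finset.sum_const, Finset.card_univ, Fintype.card_coe, nsmul_eq_mul, mul_one]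
    have : (S.card : ℝ) ≤ m + n := by exact_mod_cast hm
    rw [hQ]
    nlinarith
  obtain ⟨p, hp⟩ : ∃ p, Q ≤ R (pt p) := by
    by_contra! hcon
    have : Nonempty (Fin d → Fin M) := ⟨fun _ => ⟨0, hM⟩⟩
    have := Finset.sum_lt_sum_of_nonempty (Finset.univ_nonempty) fun p (_ : p ∈ Finset.univ) => hcon p
    simp at this
    linarith
  rcases le_or_gt Q 0 with hQ0 | hQ0
  · rw [Real.sqrt_eq_zero_of_nonpos hQ0]; simp
  set x := pt p
  have hR : 0 < R x := hQ0.trans_le hp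
  let w : EuclideanSpace ℂ S := ((Real.sqrt (R x) : ℂ))⁻¹ •
    ∑ i, (starRingEnd ℂ) (f i x) • v i
  have hwW : w ∈ W := W.smul_mem _ (W.sum_mem fun i _ => W.smul_mem _ (hvW i))
  have hsq : Real.sqrt (R x) ^ 2 = R x := Real.sq_sqrt hR.le
  have hsp : 0 < Real.sqrt (R x) := Real.sqrt_pos.2 hR
  have hwn : ‖w‖ ^ 2 = 1 := by
    have h1 : ‖∑ i, (starRingEnd ℂ) (f i x) • v i‖ ^ 2 = R x := by
      have := hv.inner_sum (fun i => (starRingEnd ℂ) (f i x)) (fun i => (starRingEnd ℂ) (f i x)) Finset.univ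
      rw [inner_self_eq_norm_sq_to_K] at this
      apply Complex.ofReal_injective
      simp only [R]
      push_cast
      refine Eq.trans ?_ (this.trans ?_)
      · simp
      · refine Finset.sum_congr rfl fun i _ => ?_
        rw [Complex.conj_conj, Complex.mul_conj']
    rw [norm_smul, mul_pow, h1]
    simp only [norm_inv, Complex.norm_real, inv_pow, Real.norm_eq_abs, sq_abs, hsq]
    field_simp
  have hwf : torusFn ω (T w) x = Real.sqrt (R x) := by
    have hlin : ∀ c : Fin m → ℂ, torusFn ω (T (∑ i, c i • v i)) x = ∑ i, c i * f i x := by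
      intro c
      simp only [f, hf, Finset.mul_sum]
      rw [Finset.sum_comm]
      refine Finset.sum_congr rfl fun k _ => ?_
      simp only [WithLp.ofLp_sum, Finset.sum_apply, PiLp.smul_apply, smul_eq_mul, Finset.mul_sum,
        Finset.sum_mul]
      refine Finset.sum_congr rfl fun i _ => by ring
    have : w = ∑ i, (((Real.sqrt (R x) : ℂ))⁻¹ * (starRingEnd ℂ) (f i x)) • v i := by
      simp only [w, Finset.smul_sum, smul_smul]
    rw [this, hlin]
    simp only [mul_assoc, ← Finset.mul_sum, Complex.conj_mul']
    have h2 : (∑ i, (‖f i x‖ : ℂ) ^ 2) = ((R x : ℝ) : ℂ) := by simp [R]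
    have h3 : ((R x : ℝ) : ℂ) = (Real.sqrt (R x) : ℂ) ^ 2 := by exact_mod_cast hsq.symm
    rw [h2, h3]
    have : (Real.sqrt (R x) : ℂ) ≠ 0 := by exact_mod_cast hsp.ne'
    field_simp
  have hn1 : ‖T w‖ ≤ 1 := by
    have : ‖T w‖ ^ 2 = 1 := by rw [hTn, hwn]
    nlinarith [norm_nonneg (T w)]
  have hneg : torusFn ω (T (-w)) x = - Real.sqrt (R x) := by
    rw [← hwf, hf, hf, ← Finset.sum_neg_distrib]
    refine Finset.sum_congr rfl fun k _ => by simp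
  have hn2 : ‖T (-w)‖ ≤ 1 := by rw [map_neg, norm_neg]; exact hn1
  have hi1 : (fun i => L i (T w)) = 0 := funext fun i => hW w hwW i
  have hi2 : (fun i => L i (T (-w))) = 0 := funext fun i => hW _ (W.neg_mem hwW) i
  have hs1 : Real.sqrt Q ≤ Real.sqrt (R x) := Real.sqrt_le_sqrt hp
  have hmax : Real.sqrt (R x) ≤ ‖torusFn ω (T w) x - φ 0 x‖ ∨
      Real.sqrt (R x) ≤ ‖torusFn ω (T (-w)) x - φ 0 x‖ := by
    by_contra! hcon
    have h1 := norm_sub_le (torusFn ω (T w) x - φ 0 x) (torusFn ω (T (-w)) x - φ 0 x)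
    have h2 : (torusFn ω (T w) x - φ 0 x) - (torusFn ω (T (-w)) x - φ 0 x) =
        ((2 * Real.sqrt (R x) : ℝ) : ℂ) := by
      rw [hwf, hneg]; push_cast; ring
    rw [h2, Complex.norm_real, Real.norm_eq_abs, abs_of_pos (by positivity)] at h1
    linarith [hcon.1, hcon.2]
  rcases hmax with h | h
  · refine le_iSup₂_of_le (T w) hn1 (le_iSup₂_of_le x (hpt p) ?_)
    rw [hi1, ← enorm_eq_nnnorm, ← ofReal_norm]
    exact ENNReal.ofReal_le_ofReal (hs1.trans h)
  · refine le_iSup₂_of_le (T (-w)) hn2 (le_iSup₂_of_le x (hpt p) ?_)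
    rw [hi2, ← enorm_eq_nnnorm, ← ofReal_norm]
    exact ENNReal.ofReal_le_ofReal (hs1.trans h)

lemma summable_of_pow_bound {ι : Type*} (lam : ι → ℝ) (h0 : ∀ k, 0 < lam k) (h1 : ∀ k, lam k ≤ 1)
    (s B : ℝ) (hs1 : s ≤ 1)
    (hB : ∀ U : Finset ι, ∑ k ∈ U, lam k ^ s ≤ B) : Summable lam ∧ ∑' k, lam k ≤ B := by
  have hle : ∀ k, lam k ≤ lam k ^ s := fun k => by
    have := Real.rpow_le_rpow_of_exponent_ge (h0 k) (h1 k) hs1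
    rwa [Real.rpow_one] at this
  have hU : ∀ U : Finset ι, ∑ k ∈ U, lam k ≤ B := fun U =>
    (Finset.sum_le_sum fun k _ => hle k).trans (hB U)
  have hs := summable_of_sum_le (fun k => (h0 k).le) hU
  exact ⟨hs, hs.tsum_le_of_sum_le hU⟩

lemma std_poly {d : ℕ} (ω : (Fin d → ℤ) → ℝ) (h0 : ∀ k, 0 < ((ω k)⁻¹) ^ 2)
    (h1 : ∀ k, ((ω k)⁻¹) ^ 2 ≤ 1) (s B : ℝ) (hs0 : 0 < s) (hs1 : s < 1) (hB1 : 1 ≤ B)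
    (hB : ∀ U : Finset (Fin d → ℤ), ∑ k ∈ U, (((ω k)⁻¹) ^ 2) ^ s ≤ B)
    (ε : ℝ) (hε : 0 < ε) (hε1 : ε < 1) :
    ∃ N : ℕ, (N : ℝ) ≤ (4 * B ^ 2 * (4 * B) ^ (s / (1 - s)) + 1) * ε ^ (-(2 * (s / (1 - s)) + 2)) ∧
      wcErr ω (stdInfo ω) N ≤ ENNReal.ofReal ε := by
  classical
  obtain ⟨hsum, hΛ⟩ := summable_of_pow_bound (fun k => ((ω k)⁻¹) ^ 2) h0 h1 s B hs1.le hB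
  set lam : (Fin d → ℤ) → ℝ := fun k => ((ω k)⁻¹) ^ 2 with hlam
  have hs' : 0 < 1 - s := by linarith
  set t : ℝ := (ε ^ 2 / (4 * B)) ^ (1 / (1 - s)) with ht
  have hbase : 0 < ε ^ 2 / (4 * B) := by positivity
  have ht0 : 0 < t := Real.rpow_pos_of_pos hbase _
  have ht1 : t ^ (1 - s) = ε ^ 2 / (4 * B) := by
    rw [ht, ← Real.rpow_mul hbase.le, one_div_mul_cancel hs'.ne', Real.rpow_one]
  have hts : t ^ (-s) = (4 * B) ^ (s / (1 - s)) * ε ^ (-(2 * (s / (1 - s)))) := by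
    rw [ht, ← Real.rpow_mul hbase.le, Real.div_rpow (by positivity) (by positivity),
      ← Real.rpow_natCast, ← Real.rpow_mul hε.le, div_eq_mul_inv, mul_comm,
      ← Real.rpow_neg (by positivity)]
    congr 1
    · congr 1; field_simp
    · congr 1; push_cast; field_simp
  have hcard : ∀ U : Finset (Fin d → ℤ), (∀ k ∈ U, t < lam k) → (U.card : ℝ) ≤ B * t ^ (-s) := by
    intro U hU
    have h2 : U.card * t ^ s ≤ B := by
      refine le_trans ?_ (hB U)
      rw [← nsmul_eq_mul]
      refine Finset.card_nsmul_le_sum U _ _ fun k hk => ?_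
      exact Real.rpow_le_rpow ht0.le (hU k hk).le hs0.le
    rw [Real.rpow_neg ht0.le, ← div_eq_mul_inv, le_div_iff₀ (by positivity)]
    exact h2
  have hfin : {k | t < lam k}.Finite := by
    have := hsum.tendsto_cofinite_zero.eventually (gt_mem_nhds ht0)
    refine Set.Finite.subset (Filter.eventually_cofinite.1 this) fun k hk => ?_
    simpa using (le_of_lt hk)
  let S := hfin.toFinset
  have hS : (S.card : ℝ) ≤ B * t ^ (-s) := hcard S fun k hk => by simpa [S] using hk
  have hT : ∀ U : Finset (Fin d → ℤ), Disjoint U S → ∑ k ∈ U, lam k ≤ ε ^ 2 / 4 := by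
    intro U hU
    have h3 : ∀ k ∈ U, lam k ≤ t ^ (1 - s) * lam k ^ s := by
      intro k hk
      have hk0 : 0 < lam k := h0 k
      have hk' : lam k ≤ t := by
        have := Finset.disjoint_left.1 hU hk
        simpa [S] using this
      calc lam k = lam k ^ (1 - s) * lam k ^ s := by
            rw [← Real.rpow_add hk0, sub_add_cancel, Real.rpow_one]
        _ ≤ _ := by
          gcongr
    calc _ ≤ ∑ k ∈ U, t ^ (1 - s) * lam k ^ s := Finset.sum_le_sum h3
      _ = t ^ (1 - s) * ∑ k ∈ U, lam k ^ s := by rw [Finset.mul_sum]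
      _ ≤ t ^ (1 - s) * B := by gcongr; exact hB U
      _ = ε ^ 2 / 4 := by rw [ht1]; field_simp
  set X : ℝ := 4 * B ^ 2 * t ^ (-s) / ε ^ 2 with hX
  have hX0 : 0 ≤ X := by positivity
  have hNX := Nat.lt_floor_add_one X
  have hNX2 := Nat.floor_le hX0
  refine ⟨⌊X⌋₊ + 1, ?_, wcErr_std_bound ω hsum S (ε ^ 2 / 4) ε hε.le hT _ ?_⟩
  · push_cast
    have e1 : X = 4 * B ^ 2 * (4 * B) ^ (s / (1 - s)) * ε ^ (-(2 * (s / (1 - s)) + 2)) := by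
      rw [hX, hts, neg_add, Real.rpow_add hε, Real.rpow_neg hε.le 2, Real.rpow_two]
      field_simp
    have e2 : 1 ≤ ε ^ (-(2 * (s / (1 - s)) + 2)) := by
      apply Real.one_le_rpow_of_pos_of_le_one_of_nonpos hε hε1.le
      have : 0 < s / (1 - s) := by positivity
      linarith
    rw [add_mul, ← e1]
    linarith
  · push_cast
    have hΛ0 : 0 ≤ ∑' k, lam k := tsum_nonneg fun k => (h0 k).le
    have h5 : (∑' k, lam k) * S.card ≤ B * (B * t ^ (-s)) := by gcongr
    have h6 : X * ε ^ 2 = 4 * B ^ 2 * t ^ (-s) := by rw [hX]; field_simp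
    have h7 : X * ε ^ 2 < (⌊X⌋₊ + 1) * ε ^ 2 := by gcongr
    nlinarith

lemma kor_inv (g r : ℕ → ℝ) (hgpos : ∀ j, 1 ≤ j → 0 < g j) (d : ℕ) (h : Fin d → ℤ) :
    ((korWeight g r d h)⁻¹) ^ 2 = ∏ j : Fin d,
      if h j = 0 then 1 else g (j.1 + 1) * |(h j : ℝ)| ^ (-(2 * r (j.1 + 1))) := by
  unfold korWeight
  rw [inv_pow, Real.sq_sqrt, ← Finset.prod_inv_distrib]
  · refine Finset.prod_congr rfl fun j _ => ?_
    split_ifs with hj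
    · simp
    · rw [mul_inv, inv_inv, Real.rpow_neg (abs_nonneg _)]
  · refine Finset.prod_nonneg fun j _ => ?_
    have := hgpos (j.1 + 1) (by omega)
    split_ifs <;> positivity

lemma kor_pos (g r : ℕ → ℝ) (hgpos : ∀ j, 1 ≤ j → 0 < g j) (d : ℕ) (h : Fin d → ℤ) :
    0 < ((korWeight g r d h)⁻¹) ^ 2 := by
  rw [kor_inv g r hgpos]
  refine Finset.prod_pos fun j _ => ?_
  have := hgpos (j.1 + 1) (by omega)
  split_ifs with hj
  · norm_num
  · have : 0 < |(h j : ℝ)| := abs_pos.2 (by exact_mod_cast hj)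
    positivity

lemma kor_fac_le {g r b s : ℝ} (hg : 0 < g) (h : ℤ) (hs : 0 < s) (hb : b ≤ 2 * r * s) :
    (if h = 0 then 1 else g * |(h : ℝ)| ^ (-(2 * r))) ^ s ≤
      (if h = 0 then 1 else 0) + g ^ s * |(h : ℝ)| ^ (-b) := by
  split_ifs with hj
  · simp; positivity
  · have h1 : 1 ≤ |(h : ℝ)| := by
      have := Int.one_le_abs hj
      exact_mod_cast this
    rw [Real.mul_rpow hg.le (by positivity), ← Real.rpow_mul (by positivity), zero_add]
    gcongr
    linarith

lemma kor_le_one (g r : ℕ → ℝ) (hgpos : ∀ j, 1 ≤ j → 0 < g j) (hg1 : ∀ j, 1 ≤ j → g j ≤ 1)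
    (hr : ∀ j, 1 ≤ j → 0 ≤ r j) (d : ℕ) (h : Fin d → ℤ) :
    ((korWeight g r d h)⁻¹) ^ 2 ≤ 1 := by
  rw [kor_inv g r hgpos]
  refine Finset.prod_le_one (fun j _ => ?_) (fun j _ => ?_)
  · have := hgpos (j.1 + 1) (by omega)
    split_ifs <;> positivity
  · have := hgpos (j.1 + 1) (by omega)
    have h2 := hg1 (j.1 + 1) (by omega)
    split_ifs with hj
    · exact le_rfl
    · have h1 : 1 ≤ |(h j : ℝ)| := by
        have := Int.one_le_abs hj
        exact_mod_cast this
      have h3 := Real.rpow_le_one_of_one_le_of_nonpos h1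
        (show -(2 * r (j.1+1)) ≤ 0 by have := hr (j.1+1) (by omega); linarith)
      exact mul_le_one₀ h2 (by positivity) h3

lemma kor_sum (g r : ℕ → ℝ) (hgpos : ∀ j, 1 ≤ j → 0 < g j)
    (hr : ∀ j, 1 ≤ j → r 1 ≤ r j) (s : ℝ) (hs : 0 < s) (hrs : 1 < 2 * r 1 * s)
    (d : ℕ) (U : Finset (Fin d → ℤ)) :
    ∑ k ∈ U, (((korWeight g r d k)⁻¹) ^ 2) ^ s ≤
      ∏ j : Fin d, (1 + g (j.1 + 1) ^ s * ∑' h : ℤ, |(h : ℝ)| ^ (-(2 * r 1 * s))) := by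
  classical
  set b := 2 * r 1 * s with hb
  have hZ : Summable fun h : ℤ => |(h : ℝ)| ^ (-b) := Real.summable_abs_int_rpow hrs
  let ψ : Fin d → ℤ → ℝ := fun j h => (if h = 0 then 1 else 0) + g (j.1 + 1) ^ s * |(h : ℝ)| ^ (-b)
  have hψ0 : ∀ j h, 0 ≤ ψ j h := by
    intro j h
    have := hgpos (j.1 + 1) (by omega)
    simp only [ψ]
    split_ifs <;> positivity
  let T : Fin d → Finset ℤ := fun j => U.image fun k => k j
  calc _ ≤ ∑ k ∈ U, ∏ j, ψ j (k j) := by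
        refine Finset.sum_le_sum fun k _ => ?_
        rw [kor_inv g r hgpos, ← Real.finsetProd_rpow]
        · refine Finset.prod_le_prod (fun j _ => ?_) (fun j _ => ?_)
          · have := hgpos (j.1 + 1) (by omega)
            split_ifs <;> positivity
          · refine kor_fac_le (hgpos (j.1 + 1) (by omega)) _ hs ?_
            have := hr (j.1 + 1) (by omega)
            rw [hb]; gcongr
        · intro j _
          have := hgpos (j.1 + 1) (by omega)
          split_ifs <;> positivity
    _ ≤ ∑ k ∈ Fintype.piFinset T, ∏ j, ψ j (k j) := by
        refine Finset.sum_le_sum_of_subset_of_nonneg ?_ ?_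
        · intro k hk
          rw [Fintype.mem_piFinset]
          intro j
          exact Finset.mem_image_of_mem _ hk
        · intro k _ _
          exact Finset.prod_nonneg fun j _ => hψ0 _ _
    _ = ∏ j, ∑ h ∈ T j, ψ j h := (Finset.prod_univ_sum _ _).symm
    _ ≤ _ := by
        refine Finset.prod_le_prod (fun j _ => Finset.sum_nonneg fun h _ => hψ0 _ _) (fun j _ => ?_)
        simp only [ψ, Finset.sum_add_distrib, ← Finset.mul_sum]
        have := hgpos (j.1 + 1) (by omega)
        gcongr
        · rw [Finset.sum_ite_eq' (T j) 0 (fun _ => (1:ℝ))]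
          split_ifs <;> norm_num
        · exact hZ.sum_le_tsum _ fun h _ => by positivity

lemma korNC_le {g r : ℕ → ℝ} {d : ℕ} {ε : ℝ} {N : ℕ} (useStd : Bool) (crit : Crit)
    (hs : Summable fun k => ((korWeight g r d k)⁻¹) ^ 2)
    (hN : wcErr (korWeight g r d) (stdInfo (korWeight g r d)) N ≤ ENNReal.ofReal ε) :
    N ∈ {n : ℕ | wcErr (korWeight g r d)
      (if useStd then stdInfo (korWeight g r d) else allInfo d) n ≤
        ENNReal.ofReal ε * CRI (korWeight g r d) crit} := by
  have h1 : 1 ≤ CRI (korWeight g r d) crit := by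
    cases crit with
    | ABS => exact le_rfl
    | NOR => exact one_le_initErr _ (by simp [korWeight])
  have h2 : wcErr (korWeight g r d) (if useStd then stdInfo (korWeight g r d) else allInfo d) N ≤
      wcErr (korWeight g r d) (stdInfo (korWeight g r d)) N := by
    apply wcErr_mono
    cases useStd
    · exact std_sub_all _ hs
    · simp
  exact (h2.trans hN).trans (le_mul_of_one_le_right zero_le h1)

lemma prod_one_le {ι : Type*} [Fintype ι] (f : ι → ℝ) (hf : ∀ i, 0 ≤ f i) : 1 ≤ ∏ i, (1 + f i) :=
  calc (1:ℝ) = ∏ _i : ι, (1:ℝ) := by simp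
    _ ≤ _ := Finset.prod_le_prod (fun _ _ => zero_le_one) (fun i _ => by linarith [hf i])

lemma suff_dir (g r : ℕ → ℝ)
    (hg1 : ∀ j, 1 ≤ j → g j ≤ 1) (hgpos : ∀ j, 1 ≤ j → 0 < g j)
    (hr1 : 1 / 2 < r 1) (hr : ∀ j, 1 ≤ j → r 1 ≤ r j)
    (crit : Crit) (useStd : Bool)
    (h : 1 < Filter.liminf (fun j : ℕ => ((Real.log (1 / g j) / Real.log j : ℝ) : EReal))
        Filter.atTop) : ALGSPT (korNC g r useStd crit) := by
  obtain ⟨c, hc1, hc2⟩ := EReal.lt_iff_exists_real_btwn.1 h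
  have hc1 : 1 < c := by exact_mod_cast hc1
  have hev := Filter.eventually_lt_of_lt_liminf hc2
  obtain ⟨s, hs1, hs2⟩ : ∃ s, max (1 / (2 * r 1)) (1 / c) < s ∧ s < 1 := by
    apply exists_between
    apply max_lt
    · rw [div_lt_one (by linarith)]; linarith
    · rw [div_lt_one (by linarith)]; linarith
  have hsr : 1 < 2 * r 1 * s := by
    have := (le_max_left _ _).trans_lt hs1
    rw [div_lt_iff₀ (by linarith)] at this; linarith
  have hsc : 1 < c * s := by
    have := (le_max_right _ _).trans_lt hs1
    rw [div_lt_iff₀ (by linarith)] at this; linarith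
  have hs0 : 0 < s := lt_trans (by positivity) ((le_max_right _ _).trans_lt hs1)
  have hgs : Summable fun j : ℕ => g j ^ s := by
    refine Summable.of_norm_bounded_eventually_nat (g := fun j : ℕ => (j : ℝ) ^ (-(c * s)))
      (Real.summable_nat_rpow.2 (by linarith)) ?_
    filter_upwards [hev, Filter.eventually_ge_atTop 2] with j hj hj2
    have hj : c < Real.log (1 / g j) / Real.log j := by exact_mod_cast hj
    have hgj := hgpos j (by omega)
    have hj2' : (1:ℝ) < j := by exact_mod_cast hj2
    have hlog := Real.log_pos hj2'
    rw [lt_div_iff₀ hlog, one_div, Real.log_inv] at hj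
    have h1 : g j ≤ (j : ℝ) ^ (-c) := by
      rw [← Real.log_le_log_iff hgj (by positivity), Real.log_rpow (by positivity)]
      linarith
    rw [Real.norm_of_nonneg (by positivity)]
    calc g j ^ s ≤ ((j : ℝ) ^ (-c)) ^ s := by gcongr
      _ = _ := by rw [← Real.rpow_mul (by positivity)]; congr 1; ring
  have hgs' : Summable fun j : ℕ => g (j + 1) ^ s :=
    (summable_nat_add_iff (f := fun j => g j ^ s) 1).2 hgs
  set Z := ∑' h : ℤ, |(h : ℝ)| ^ (-(2 * r 1 * s)) with hZ
  have hZ0 : 0 ≤ Z := tsum_nonneg fun h => by positivity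
  set G := ∑' j : ℕ, g (j + 1) ^ s
  have hgs0 : ∀ j, 0 ≤ g (j + 1) ^ s := fun j => by
    have := hgpos (j+1) (by omega); positivity
  have hG0 : 0 ≤ G := tsum_nonneg hgs0
  set B := Real.exp (G * Z)
  have hB1 : 1 ≤ B := Real.one_le_exp (by positivity)
  have hB : ∀ d, ∀ U : Finset (Fin d → ℤ), ∑ k ∈ U, (((korWeight g r d k)⁻¹) ^ 2) ^ s ≤ B := by
    intro d U
    refine (kor_sum g r hgpos hr s hs0 hsr d U).trans ?_
    calc _ ≤ ∏ j : Fin d, Real.exp (g (j.1 + 1) ^ s * Z) := by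
          refine Finset.prod_le_prod (fun j _ => ?_) (fun j _ => ?_)
          · have := hgs0 j.1; positivity
          · rw [add_comm]; exact Real.add_one_le_exp _
      _ = Real.exp ((∑ j : Fin d, g (j.1 + 1) ^ s) * Z) := by
          rw [← Real.exp_sum, Finset.sum_mul]
      _ ≤ _ := by
          apply Real.exp_le_exp.2
          gcongr
          rw [Fin.sum_univ_eq_sum_range (fun j => g (j + 1) ^ s)]
          exact hgs'.sum_le_tsum _ fun j _ => hgs0 j
  have hp0 : 0 < s / (1 - s) := div_pos hs0 (by linarith)
  refine ⟨4 * B ^ 2 * (4 * B) ^ (s / (1 - s)) + 1, by positivity, 2 * (s / (1 - s)) + 2,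
    by positivity, ?_⟩
  intro d _ ε hε
  have hk0 := kor_pos g r hgpos d
  have hk1 := kor_le_one g r hgpos hg1 (fun j hj => by linarith [hr j hj]) d
  obtain ⟨N, hN, hN2⟩ := std_poly (korWeight g r d) hk0 hk1 s B hs0 hs2 hB1 (hB d) ε hε.1 hε.2
  refine le_trans ?_ hN
  have hsum := (summable_of_pow_bound _ hk0 hk1 s B hs2.le (hB d)).1
  exact_mod_cast Nat.sInf_le (korNC_le useStd crit hsum hN2)

lemma kor_summable (g r : ℕ → ℝ)
    (hg1 : ∀ j, 1 ≤ j → g j ≤ 1) (hgpos : ∀ j, 1 ≤ j → 0 < g j)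
    (hr1 : 1 / 2 < r 1) (hr : ∀ j, 1 ≤ j → r 1 ≤ r j) (d : ℕ) :
    (Summable fun k => ((korWeight g r d k)⁻¹) ^ 2) ∧ ∀ ε : ℝ, 0 < ε → ε < 1 → ∃ N,
      wcErr (korWeight g r d) (stdInfo (korWeight g r d)) N ≤ ENNReal.ofReal ε := by
  obtain ⟨s, hs1, hs2⟩ : ∃ s, (1 / (2 * r 1)) < s ∧ s < 1 := by
    apply exists_between
    rw [div_lt_one (by linarith)]; linarith
  have hsr : 1 < 2 * r 1 * s := by
    rw [div_lt_iff₀ (by linarith)] at hs1; linarith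
  have hs0 : 0 < s := lt_trans (by positivity) hs1
  have hk0 := kor_pos g r hgpos d
  have hk1 := kor_le_one g r hgpos hg1 (fun j hj => by linarith [hr j hj]) d
  have hB := kor_sum g r hgpos hr s hs0 hsr d
  refine ⟨(summable_of_pow_bound _ hk0 hk1 s _ hs2.le hB).1, fun ε h0 h1 => ?_⟩
  obtain ⟨N, -, hN⟩ := std_poly (korWeight g r d) hk0 hk1 s _ hs0 hs2
    (prod_one_le _ fun j => mul_nonneg
      (by have := hgpos (j.1+1) (by omega); positivity) (tsum_nonneg fun h => by positivity))
    hB ε h0 h1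
  exact ⟨N, hN⟩

set_option maxHeartbeats 1000000 in
lemma nec_dir (g r : ℕ → ℝ)
    (hg1 : ∀ j, 1 ≤ j → g j ≤ 1) (hgpos : ∀ j, 1 ≤ j → 0 < g j)
    (hganti : ∀ i j, 1 ≤ i → i ≤ j → g j ≤ g i)
    (hr1 : 1 / 2 < r 1) (hr : ∀ j, 1 ≤ j → r 1 ≤ r j)
    (crit : Crit) (useStd : Bool)
    (h : ALGPT (korNC g r useStd crit)) :
    1 < Filter.liminf (fun j : ℕ => ((Real.log (1 / g j) / Real.log j : ℝ) : EReal))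
        Filter.atTop := by
  classical
  obtain ⟨C, hC, p, hp, q, hq, hPT⟩ := h
  by_contra! hlim
  let Λ : ℕ → ℝ := fun d => ∑' k, ((korWeight g r d k)⁻¹) ^ 2
  have hΛ0 : ∀ d, 0 ≤ Λ d := fun d => tsum_nonneg fun k => by positivity
  have key : ∀ d : ℕ, 0 < d → ∀ ε ∈ Set.Ioo (0:ℝ) 1, ∃ n : ℕ, (n : ℝ) ≤ C * (d : ℝ) ^ q * ε ^ (-p) ∧
      ∀ (S : Finset (Fin d → ℤ)) (μ : (Fin d → ℤ) → ℝ) (B : ℝ),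
        (∀ k ∈ S, μ k ≤ ((korWeight g r d k)⁻¹) ^ 2) → (∀ k ∈ S, μ k ≤ B) → 0 ≤ B →
        ∑ k ∈ S, μ k - n * B ≤ ε ^ 2 * Λ d := by
    intro d hd ε hε
    refine ⟨_, hPT d hd ε hε, fun S μ B h1 h2 h3 => ?_⟩
    obtain ⟨hsum, hN⟩ := kor_summable g r hg1 hgpos hr1 hr d
    obtain ⟨N, hN⟩ := hN ε hε.1 hε.2
    have hmem := Nat.sInf_mem ⟨N, korNC_le useStd crit hsum hN⟩
    have h4 : wcErr (korWeight g r d) (allInfo d) (korNC g r useStd crit d ε) ≤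
        ENNReal.ofReal ε * CRI (korWeight g r d) crit := by
      refine le_trans (wcErr_mono _ ?_ _) hmem
      cases useStd
      · simp
      · exact std_sub_all _ hsum
    have h5 : CRI (korWeight g r d) crit ≤ ENNReal.ofReal (Real.sqrt (Λ d)) := by
      refine le_trans ?_ (initErr_le _ hsum)
      cases crit with
      | ABS => exact one_le_initErr _ (by simp [korWeight])
      | NOR => exact le_rfl
    have h6 := (wcErr_all_lower _ _ S μ B h1 h2 h3).trans (h4.trans (mul_le_mul_right h5 _))
    rw [← ENNReal.ofReal_mul hε.1.le] at h6
    have h7 : 0 ≤ ε * Real.sqrt (Λ d) := mul_nonneg hε.1.le (Real.sqrt_nonneg _)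
    rw [ENNReal.ofReal_le_ofReal_iff h7, Real.sqrt_le_iff, mul_pow, Real.sq_sqrt (hΛ0 d)] at h6
    exact h6.2
  -- Step 1
  obtain ⟨C1, hC1, hΛ⟩ : ∃ C1 : ℝ, 1 ≤ C1 ∧ ∀ d : ℕ, 0 < d → Λ d ≤ C1 * (d : ℝ) ^ q := by
    refine ⟨max 1 (4 / 3 * (C * (1/2 : ℝ) ^ (-p))), le_max_left _ _, fun d hd => ?_⟩
    obtain ⟨n, hn, hn2⟩ := key d hd (1/2) ⟨by norm_num, by norm_num⟩
    have hsum := (kor_summable g r hg1 hgpos hr1 hr d).1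
    have h1 : Λ d ≤ (1/2) ^ 2 * Λ d + n := hsum.tsum_le_of_sum_le fun S => by
      have := hn2 S _ 1 (fun k _ => le_rfl)
        (fun k _ => kor_le_one g r hgpos hg1 (fun j hj => by linarith [hr j hj]) d k) zero_le_one
      linarith
    have h2 : Λ d ≤ 4 / 3 * (C * (1/2 : ℝ) ^ (-p)) * (d:ℝ) ^ q := by nlinarith
    refine h2.trans ?_
    gcongr
    exact le_max_right _ _
  -- Step 2
  obtain ⟨m, hm⟩ := exists_nat_gt (q + (1 + q) * (p / 2))
  have hm0 : (0:ℝ) < m := lt_of_le_of_lt (by positivity) hm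
  have hm1 : 0 < m := by exact_mod_cast hm0
  have hfreq : ∃ᶠ j : ℕ in atTop, ((Real.log (1 / g j) / Real.log j : ℝ) : EReal) <
      ((1 + 1 / m : ℝ) : EReal) := by
    refine Filter.frequently_lt_of_liminf_lt (by isBoundedDefault) (lt_of_le_of_lt hlim ?_)
    have : (1:ℝ) < 1 + 1 / m := by
      have : (0:ℝ) < 1 / m := by positivity
      linarith
    exact_mod_cast this
  set c : ℝ := 1 / (2 ^ m * m.factorial) with hc
  have hc0 : 0 < c := by positivity
  have hc1 : c ≤ 1 := by
    rw [hc, div_le_one (by positivity)]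
    have h1 : (1:ℝ) ≤ 2 ^ m := one_le_pow₀ (by norm_num)
    have h2 : (1:ℝ) ≤ m.factorial := by exact_mod_cast m.factorial_pos
    nlinarith
  set K : ℝ := (c / (2 * C1)) ^ (-(p / 2)) with hK
  have hlarge : ∀ᶠ d : ℕ in atTop, 2 * C * K / c < (d : ℝ) ^ (m - (q + (1 + q) * (p / 2))) :=
    ((tendsto_rpow_atTop (sub_pos.2 hm)).comp tendsto_natCast_atTop_atTop).eventually_gt_atTop _
  obtain ⟨d, hfd, hld, hd2⟩ :=
    (hfreq.and_eventually (hlarge.and (Filter.eventually_ge_atTop (2 * m + 2)))).exists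
  have hfd : Real.log (1 / g d) / Real.log d < 1 + 1 / m := by exact_mod_cast hfd
  have hd0 : 0 < d := by omega
  have hdR : (1:ℝ) < d := by exact_mod_cast (show 1 < d by omega)
  have hdR0 : (0:ℝ) < d := by linarith
  have hgd := hgpos d hd0
  have hgm : ((d : ℝ) ^ (m + 1))⁻¹ ≤ g d ^ m := by
    rw [div_lt_iff₀ (Real.log_pos hdR), one_div, Real.log_inv] at hfd
    rw [← Real.log_le_log_iff (by positivity) (by positivity), Real.log_inv, Real.log_pow,
      Real.log_pow]
    have : (m : ℝ) * (1 + 1 / m) = m + 1 := by field_simp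
    have h8 := mul_lt_mul_of_pos_left hfd hm0
    rw [← mul_assoc, this, mul_neg] at h8
    push_cast
    linarith
  set τ : ℝ := ((d : ℝ) ^ (m + 1))⁻¹ with hτ
  have hτ0 : 0 < τ := by positivity
  let ind : Finset (Fin d) → (Fin d → ℤ) := fun U j => if j ∈ U then 1 else 0
  have hind : Function.Injective ind := by
    intro U V hUV
    ext j
    have := congrFun hUV j
    by_cases h1 : j ∈ U <;> by_cases h2 : j ∈ V <;> simp_all [ind]
  let S : Finset (Fin d → ℤ) := (Finset.powersetCard m Finset.univ).image ind
  have hScard : S.card = d.choose m := by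
    rw [Finset.card_image_of_injective _ hind, Finset.card_powersetCard, Finset.card_univ,
      Fintype.card_fin]
  have hSc : c * (d : ℝ) ^ m ≤ S.card := by
    rw [hScard]
    refine le_trans ?_ (Nat.pow_le_choose m d)
    have h1 : (d : ℝ) / 2 ≤ ((d + 1 - m : ℕ) : ℝ) := by
      rw [div_le_iff₀ (by norm_num)]
      exact_mod_cast (show d ≤ (d + 1 - m) * 2 by omega)
    calc c * (d : ℝ) ^ m = ((d : ℝ) / 2) ^ m / m.factorial := by
          rw [hc, div_pow]; field_simp
      _ ≤ _ := by gcongr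
  have hSlam : ∀ k ∈ S, τ ≤ ((korWeight g r d k)⁻¹) ^ 2 := by
    intro k hk
    obtain ⟨U, hU, rfl⟩ := Finset.mem_image.1 hk
    have hUc := (Finset.mem_powersetCard.1 hU).2
    rw [kor_inv g r hgpos]
    refine hgm.trans ?_
    have : ∀ j : Fin d, (if ind U j = 0 then (1:ℝ) else
        g (j.1 + 1) * |((ind U j : ℤ) : ℝ)| ^ (-(2 * r (j.1 + 1)))) =
        if j ∈ U then g (j.1 + 1) else 1 := by
      intro j
      by_cases hj : j ∈ U <;> simp [ind, hj]
    simp only [this]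
    rw [Finset.prod_ite_mem, Finset.univ_inter, ← hUc, ← Finset.prod_const]
    refine Finset.prod_le_prod (fun j _ => hgd.le) fun j _ => hganti _ _ (by omega) (by omega)
  set E : ℝ := c / (2 * C1) * (d : ℝ) ^ (-(1 + q)) with hE
  have hE0 : 0 < E := by positivity
  have hE1 : E < 1 := by
    have h1 : c / (2 * C1) ≤ 1 / 2 := by
      rw [div_le_div_iff₀ (by positivity) (by norm_num)]; linarith
    have h2 : (d : ℝ) ^ (-(1 + q)) ≤ 1 :=
      Real.rpow_le_one_of_one_le_of_nonpos hdR.le (by linarith)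
    have h3 : 0 < (d : ℝ) ^ (-(1 + q)) := by positivity
    calc E ≤ 1 / 2 * 1 := mul_le_mul h1 h2 h3.le (by norm_num)
      _ < 1 := by norm_num
  obtain ⟨n, hn, hn2⟩ := key d hd0 (Real.sqrt E) ⟨Real.sqrt_pos.2 hE0, by
    rw [Real.sqrt_lt' one_pos]; simpa using hE1⟩
  have h1 := hn2 S (fun _ => τ) τ hSlam (fun _ _ => le_rfl) hτ0.le
  rw [Real.sq_sqrt hE0.le] at h1
  simp only [Finset.sum_const, nsmul_eq_mul] at h1
  have h2 : E * Λ d ≤ c / 2 * (d : ℝ)⁻¹ := by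
    calc E * Λ d ≤ E * (C1 * (d : ℝ) ^ q) := by gcongr; exact hΛ d hd0
      _ = c / 2 * ((d : ℝ) ^ (-(1 + q)) * (d : ℝ) ^ q) := by rw [hE]; field_simp
      _ = _ := by
        rw [← Real.rpow_add hdR0, show -(1 + q) + q = -1 by ring, Real.rpow_neg_one]
  have h3 : (S.card : ℝ) - n ≤ c / 2 * (d : ℝ) ^ m := by
    have h4 : ((S.card : ℝ) - n) * τ ≤ c / 2 * (d : ℝ)⁻¹ := by linarith
    have h5 : c / 2 * (d : ℝ)⁻¹ = (c / 2 * (d : ℝ) ^ m) * τ := by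
      rw [hτ, pow_succ]; field_simp
    rw [h5] at h4
    exact le_of_mul_le_mul_right h4 hτ0
  have h4 : c / 2 * (d : ℝ) ^ m ≤ n := by linarith
  have h5 : (Real.sqrt E) ^ (-p) = K * (d : ℝ) ^ ((1 + q) * (p / 2)) := by
    rw [Real.sqrt_eq_rpow, ← Real.rpow_mul hE0.le, hE, Real.mul_rpow (by positivity) (by positivity),
      ← Real.rpow_mul hdR0.le, hK]
    congr 1
    · congr 1; ring
    · congr 1; ring
  rw [h5] at hn
  have h6 : c / 2 * (d : ℝ) ^ m ≤ C * K * (d : ℝ) ^ (q + (1 + q) * (p / 2)) := by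
    rw [Real.rpow_add hdR0]
    linarith
  rw [Real.rpow_sub hdR0, Real.rpow_natCast, lt_div_iff₀ (by positivity), div_mul_eq_mul_div,
    div_lt_iff₀ hc0] at hld
  linarith

/-- For the weighted Korobov spaces (with `1 ≥ g₁ ≥ g₂ ≥ ⋯ > 0`,
`1/2 < r₁ ≤ r₂ ≤ ⋯`), for either information class and either error criterion,
ALG-SPT ⟺ ALG-PT ⟺ `liminf_j ln(1/g_j)/ln j > 1`. -/
theorem stmt12
    (g r : ℕ → ℝ)
    (hg1 : g 1 ≤ 1) (hgpos : ∀ j, 1 ≤ j → 0 < g j)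
    (hgmono : ∀ j, 1 ≤ j → g (j + 1) ≤ g j)
    (hr1 : 1 / 2 < r 1) (hrmono : ∀ j, 1 ≤ j → r j ≤ r (j + 1))
    (crit : Crit) (useStd : Bool) :
    (ALGSPT (korNC g r useStd crit) ↔ ALGPT (korNC g r useStd crit)) ∧
    (ALGPT (korNC g r useStd crit) ↔
      1 < Filter.liminf (fun j : ℕ => ((Real.log (1 / g j) / Real.log j : ℝ) : EReal))
        Filter.atTop) := by
  have hganti : ∀ i j, 1 ≤ i → i ≤ j → g j ≤ g i := by
    intro i j hi hij
    induction j, hij using Nat.le_induction with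
    | base => exact le_rfl
    | succ n hn ih => exact (hgmono n (hi.trans hn)).trans ih
  have hr : ∀ j, 1 ≤ j → r 1 ≤ r j := by
    intro j hj
    induction j, hj using Nat.le_induction with
    | base => exact le_rfl
    | succ n hn ih => exact ih.trans (hrmono n hn)
  have hg1' : ∀ j, 1 ≤ j → g j ≤ 1 := fun j hj => (hganti 1 j le_rfl hj).trans hg1
  have h12 : ALGSPT (korNC g r useStd crit) → ALGPT (korNC g r useStd crit) := by
    rintro ⟨C, hC, p, hp, h⟩
    refine ⟨C, hC, p, hp, 0, le_rfl, fun d hd ε hε => ?_⟩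
    simpa using h d hd ε hε
  have h23 := nec_dir g r hg1' hgpos hganti hr1 hr crit useStd
  have h31 := suff_dir g r hg1' hgpos hr1 hr crit useStd
  exact ⟨⟨h12, fun h => h31 (h23 h)⟩, ⟨h23, fun h => h12 (h31 h)⟩⟩
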